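/- Two finitely generated abelian groups with isomorphic profinite completions are isomorphic. -/

import Mathlib

/-- The index category for the profinite completion: finite-index normal subgroups. -/
structure FinIndexNormal (G : Type*) [Group G] where
  N : Subgroup G
  normal : N.Normal
  finiteIndex : N.FiniteIndex

instance {G : Type*} [Group G] (N : FinIndexNormal G) : N.N.Normal := N.normal
instance {G : Type*} [Group G] (N : FinIndexNormal G) : N.N.FiniteIndex := N.finiteIndex

/-- The transition map `G ⧸ N → G ⧸ M` for `N ≤ M`. -/
def transMap {G : Type*} [Group G] (N M : FinIndexNormal G) (h : N.N ≤ M.N) :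
    G ⧸ N.N →* G ⧸ M.N :=
  QuotientGroup.map N.N M.N (MonoidHom.id G) (by simpa using h)

/-- The profinite completion of `G`, as a subgroup of the product of all finite
quotients `G ⧸ N`: the compatible families. -/
def profiniteCompletionSubgroup (G : Type*) [Group G] :
    Subgroup (Π N : FinIndexNormal G, G ⧸ N.N) where
  carrier := {x | ∀ (N M : FinIndexNormal G) (h : N.N ≤ M.N), transMap N M h (x N) = x M}
  one_mem' := by intro N M h; simp
  mul_mem' := by intro x y hx hy N M h; simp [hx N M h, hy N M h]
  inv_mem' := by intro x hx N M h; simp [← hx N M h]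

/-- The profinite completion of a group `G`: the inverse limit of its finite
quotients `G ⧸ N` over finite-index normal subgroups `N`. -/
def ProfiniteCompletion (G : Type*) [Group G] : Type _ :=
  profiniteCompletionSubgroup G

instance (G : Type*) [Group G] : Group (ProfiniteCompletion G) :=
  inferInstanceAs (Group (profiniteCompletionSubgroup G))

/-- Each finite quotient carries the discrete topology. -/
instance {G : Type*} [Group G] (N : FinIndexNormal G) : TopologicalSpace (G ⧸ N.N) := ⊥

instance (G : Type*) [Group G] : TopologicalSpace (ProfiniteCompletion G) :=
  inferInstanceAs (TopologicalSpace (profiniteCompletionSubgroup G))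

/-- The natural map `ι : G → Ĝ`, sending `g` to the compatible family `(gN)`. -/
def profiniteCompletionMap (G : Type*) [Group G] : G →* ProfiniteCompletion G where
  toFun g := ⟨fun N => QuotientGroup.mk g, fun N M h => rfl⟩
  map_one' := Subtype.ext (funext fun N => rfl)
  map_mul' x y := Subtype.ext (funext fun N => rfl)

/-- A group is residually finite if every nontrivial element survives in some
finite quotient. -/
def ResiduallyFinite (G : Type*) [Group G] : Prop :=
  ∀ g : G, g ≠ 1 → ∃ N : Subgroup G, N.Normal ∧ N.FiniteIndex ∧ g ∉ N

/-- The projection `Ĝ → G ⧸ N`. -/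
def ProfiniteCompletion.proj {G : Type*} [Group G] (N : FinIndexNormal G) :
    ProfiniteCompletion G →* G ⧸ N.N :=
  (Pi.evalMonoidHom _ N).comp (profiniteCompletionSubgroup G).subtype

instance {G : Type*} [Group G] : Preorder (FinIndexNormal G) :=
  Preorder.lift FinIndexNormal.N

instance {G : Type*} [Group G] : IsCodirectedOrder (FinIndexNormal G) where
  directed N M := ⟨⟨N.N ⊓ M.N, inferInstance, inferInstance⟩,
    (inf_le_left : N.N ⊓ M.N ≤ N.N), (inf_le_right : N.N ⊓ M.N ≤ M.N)⟩

open CategoryTheory in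
/-- By compactness, an element of `Ĝ` all of whose components are `n`-th powers is itself an
`n`-th power. -/
theorem ProfiniteCompletion.exists_pow_eq {G : Type*} [Group G] (n : ℕ)
    (x : ProfiniteCompletion G) (hx : ∀ N, ∃ y, y ^ n = proj N x) : ∃ y, y ^ n = x := by
  let F : FinIndexNormal G ⥤ Type _ :=
    { obj := fun N => {y : G ⧸ N.N // y ^ n = proj N x}
      map := fun {N M} f => ↾(fun y => ⟨transMap N M f.le y.1, by
        rw [← map_pow, y.2]; exact x.2 N M f.le⟩)
      map_id := by
        intro N
        ext ⟨y, hy⟩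
        induction y using QuotientGroup.induction_on
        rfl
      map_comp := by
        intro N M K f g
        ext ⟨y, hy⟩
        induction y using QuotientGroup.induction_on
        rfl }
  have (N : FinIndexNormal G) : Finite (F.obj N) :=
    inferInstanceAs (Finite {y : G ⧸ N.N // y ^ n = proj N x})
  have (N : FinIndexNormal G) : Nonempty (F.obj N) := let ⟨y, hy⟩ := hx N; ⟨⟨y, hy⟩⟩
  obtain ⟨s, hs⟩ := nonempty_sections_of_finite_cofiltered_system F
  exact ⟨⟨fun N => (s N).1, fun N M h => congrArg Subtype.val (hs (homOfLE h))⟩,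
    Subtype.ext (funext fun N => (s N).2)⟩

/-- A finite quotient of `G` by the set of `n`-th powers is also a quotient of `Ĝ` by the set of
`n`-th powers. -/
theorem ProfiniteCompletion.exists_hom_of_ker_eq_pow {G P : Type*} [Group G] [Group P] [Finite P]
    (n : ℕ) (q : G →* P) (hq : Function.Surjective q) (hker : ∀ g, q g = 1 ↔ ∃ b, b ^ n = g) :
    ∃ f : ProfiniteCompletion G →* P, Function.Surjective f ∧ ∀ x, f x = 1 ↔ ∃ y, y ^ n = x := by
  let K : FinIndexNormal G := ⟨q.ker, inferInstance, inferInstance⟩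
  let e : G ⧸ K.N ≃* P := QuotientGroup.quotientKerEquivOfSurjective q hq
  refine ⟨e.toMonoidHom.comp (proj K), fun p => ?_, fun x => ?_⟩
  · obtain ⟨g, rfl⟩ := hq p
    exact ⟨profiniteCompletionMap G g, rfl⟩
  constructor
  · intro h
    have hK : proj K x = 1 := e.map_eq_one_iff.1 h
    refine exists_pow_eq n x fun N => ?_
    let M : FinIndexNormal G := ⟨N.N ⊓ K.N, inferInstance, inferInstance⟩
    obtain ⟨a, ha⟩ := QuotientGroup.mk_surjective (proj M x)
    have haN : (a : G ⧸ N.N) = proj N x := by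
      have := x.2 M N inf_le_left
      rw [← show _ = x.1 M from ha] at this
      exact this
    have haK : (a : G ⧸ K.N) = proj K x := by
      have := x.2 M K inf_le_right
      rw [← show _ = x.1 M from ha] at this
      exact this
    rw [hK, QuotientGroup.eq_one_iff] at haK
    obtain ⟨b, rfl⟩ := (hker a).1 haK
    exact ⟨b, haN⟩
  · rintro ⟨y, rfl⟩
    obtain ⟨g, hg⟩ := hq (e (proj K y))
    change e (proj K (y ^ n)) = 1
    rw [map_pow, map_pow, ← hg, ← map_pow]
    exact (hker _).2 ⟨g, rfl⟩

/-- Isomorphic groups have isomorphic quotients by the set of `n`-th powers. -/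
theorem MulEquiv.nonempty_quotient_pow {X Y P Q : Type*} [Group X] [Group Y] [Group P] [Group Q]
    (e : X ≃* Y) (n : ℕ) (f : X →* P) (hf : Function.Surjective f)
    (hfker : ∀ x, f x = 1 ↔ ∃ y, y ^ n = x) (g : Y →* Q) (hg : Function.Surjective g)
    (hgker : ∀ x, g x = 1 ↔ ∃ y, y ^ n = x) : Nonempty (P ≃* Q) := by
  have hmap : f.ker.map (e : X →* Y) = g.ker := by
    ext y
    rw [Subgroup.map_equiv_eq_comap_symm]
    simp only [Subgroup.mem_comap, MonoidHom.mem_ker, hgker, hfker]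
    constructor
    · rintro ⟨z, hz⟩
      exact ⟨e z, by rw [← map_pow, hz]; exact e.apply_symm_apply y⟩
    · rintro ⟨z, rfl⟩
      exact ⟨e.symm z, (map_pow e.symm z n).symm⟩
  exact ⟨(QuotientGroup.quotientKerEquivOfSurjective f hf).symm.trans
    ((QuotientGroup.congr _ _ e hmap).trans (QuotientGroup.quotientKerEquivOfSurjective g hg))⟩

/-- The quotient of `ℤ ^ r × T` by multiples of `n` is `(ℤ/n) ^ r × T` when `n` kills `T`. -/
theorem exists_hom_zmod_prod {G T : Type*} [CommGroup G] [AddCommGroup T] {r : ℕ}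
    (e : Additive G ≃+ (Fin r → ℤ) × T) (n : ℕ) (hn : ∀ t : T, n • t = 0) :
    ∃ q : G →* Multiplicative ((Fin r → ZMod n) × T),
      Function.Surjective q ∧ ∀ g, q g = 1 ↔ ∃ b, b ^ n = g := by
  let c : (Fin r → ℤ) × T →+ (Fin r → ZMod n) × T :=
    ((Int.castAddHom (ZMod n)).compLeft (Fin r)).prodMap (AddMonoidHom.id T)
  refine ⟨AddMonoidHom.toMultiplicativeRight (c.comp e.toAddMonoidHom), ?_, fun g => ?_⟩
  · rintro ⟨v, t⟩
    choose w hw using fun i => ZMod.intCast_surjective (v i)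
    refine ⟨(e.symm (w, t)).toMul, ?_⟩
    change c (e (e.symm (w, t))) = (v, t)
    rw [e.apply_symm_apply]
    exact Prod.ext (funext hw) rfl
  · change c (e (Additive.ofMul g)) = 0 ↔ _
    constructor
    · intro h
      have h₁ (i) : (n : ℤ) ∣ (e (Additive.ofMul g)).1 i :=
        (ZMod.intCast_zmod_eq_zero_iff_dvd _ _).1 (congrFun (congrArg Prod.fst h) i)
      choose w hw using h₁
      refine ⟨(e.symm (w, 0)).toMul, ?_⟩
      apply Additive.ofMul.injective
      rw [ofMul_pow, ofMul_toMul, ← map_nsmul, e.symm_apply_eq]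
      refine Prod.ext (funext fun i => ?_) ?_
      · simp [hw]
      · have h₂ : (e (Additive.ofMul g)).2 = 0 := congrArg Prod.snd h
        simp [h₂]
    · rintro ⟨b, rfl⟩
      rw [ofMul_pow, map_nsmul, map_nsmul]
      refine Prod.ext (funext fun i => ?_) (hn _)
      simp

/-- A finitely generated abelian group is `ℤ ^ r × T` with `T` finite. -/
theorem exists_equiv_free_prod_finite (G : Type*) [CommGroup G] [Group.FG G] :
    ∃ (r : ℕ) (T : Type) (_ : AddCommGroup T) (_ : Finite T),
      Nonempty (Additive G ≃+ (Fin r → ℤ) × T) := by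
  obtain ⟨r, ι, _, p, hp, k, ⟨e⟩⟩ := AddCommGroup.equiv_free_prod_directSum_zmod (Additive G)
  have (i : ι) : NeZero (p i ^ k i) := ⟨pow_ne_zero _ (hp i).ne_zero⟩
  exact ⟨r, ∀ i, ZMod (p i ^ k i), inferInstance, inferInstance,
    ⟨e.trans (Finsupp.addEquivFunOnFinite.prodCongr (DirectSum.addEquivProd _))⟩⟩

/-- If `N` kills `T`, an isomorphism `(ℤ/N²) ^ r × T ≃ (ℤ/N²) ^ s × S` induces an embedding
of `T` into `S`, via the second projection. -/
theorem injective_snd_equiv_zmod_sq_prod {T S : Type*} [AddCommGroup T] [AddCommGroup S]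
    {r s N : ℕ} (hN : N ≠ 0) (hT : ∀ t : T, N • t = 0)
    (φ : (Fin r → ZMod (N ^ 2)) × T ≃+ (Fin s → ZMod (N ^ 2)) × S) :
    Function.Injective (((AddMonoidHom.snd _ S).comp φ.toAddMonoidHom).comp
      (AddMonoidHom.inr (Fin r → ZMod (N ^ 2)) T)) := by
  rw [injective_iff_map_eq_zero]
  intro t ht
  replace ht : (φ (0, t)).2 = 0 := ht
  have hNv : N • φ (0, t) = 0 := by
    rw [← map_nsmul, Prod.smul_mk, hT, smul_zero]
    exact map_zero φ
  have hdiv (i) : ∃ w : ZMod (N ^ 2), N • w = (φ (0, t)).1 i := by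
    have h : N • (φ (0, t)).1 i = 0 := congrFun (congrArg Prod.fst hNv) i
    obtain ⟨z, hz⟩ := ZMod.intCast_surjective ((φ (0, t)).1 i)
    rw [← hz, nsmul_eq_mul] at h
    have h' : ((N * z : ℤ) : ZMod (N ^ 2)) = 0 := by push_cast; exact h
    rw [ZMod.intCast_zmod_eq_zero_iff_dvd, Nat.cast_pow, sq] at h'
    obtain ⟨w, rfl⟩ := Int.dvd_of_mul_dvd_mul_left (by exact_mod_cast hN) h'
    exact ⟨w, by rw [← hz]; simp⟩
  choose w hw using hdiv
  have h : φ (0, t) = N • ((w, 0) : _ × S) :=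
    Prod.ext (funext fun i => (hw i).symm) (by simp [ht])
  rw [← φ.apply_symm_apply (w, 0), ← map_nsmul, φ.injective.eq_iff] at h
  exact (congrArg Prod.snd h).trans (hT _)

/-- The rank and the torsion of `ℤ ^ r × T` are determined by its quotients `(ℤ/n) ^ r × T`. -/
theorem rank_eq_and_nonempty_equiv_of_zmod_prod {T S : Type*} [AddCommGroup T] [AddCommGroup S]
    [Finite T] [Finite S] {r s : ℕ}
    (h : ∀ n : ℕ, n ≠ 0 → (∀ t : T, n • t = 0) → (∀ t : S, n • t = 0) →
      Nonempty ((Fin r → ZMod n) × T ≃+ (Fin s → ZMod n) × S)) :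
    r = s ∧ Nonempty (T ≃+ S) := by
  obtain ⟨N, hNdef⟩ : ∃ N, N = Nat.card T * Nat.card S := ⟨_, rfl⟩
  have hN : N ≠ 0 := hNdef ▸ mul_ne_zero Nat.card_pos.ne' Nat.card_pos.ne'
  have hT (m : ℕ) (t : T) : (m * N) • t = 0 := by
    rw [hNdef, mul_left_comm, mul_comm, mul_smul, card_nsmul_eq_zero', smul_zero]
  have hS (m : ℕ) (t : S) : (m * N) • t = 0 := by
    rw [hNdef, ← mul_assoc, mul_smul, card_nsmul_eq_zero', smul_zero]
  have hcard (m : ℕ) (hm : m ≠ 0) :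
      (m * N) ^ r * Nat.card T = (m * N) ^ s * Nat.card S := by
    obtain ⟨φ⟩ := h (m * N) (mul_ne_zero hm hN) (hT m) (hS m)
    simpa [Nat.card_prod, Nat.card_fun] using Nat.card_congr φ.toEquiv
  have h₁ : N ^ r * Nat.card T = N ^ s * Nat.card S := by simpa using hcard 1 one_ne_zero
  have hrs : r = s := by
    have h₂ := hcard 2 two_ne_zero
    rw [mul_pow, mul_pow, mul_assoc, mul_assoc, h₁] at h₂
    exact Nat.pow_right_injective le_rfl
      (Nat.eq_of_mul_eq_mul_right (Nat.mul_pos (pow_pos hN.bot_lt _) Nat.card_pos) h₂)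
  refine ⟨hrs, ?_⟩
  have hTS : Nat.card T = Nat.card S := by
    rw [hrs] at h₁
    exact Nat.eq_of_mul_eq_mul_left (pow_pos hN.bot_lt _) h₁
  obtain ⟨φ⟩ := h (N ^ 2) (pow_ne_zero 2 hN) (by rw [sq]; exact hT N) (by rw [sq]; exact hS N)
  have hinj := injective_snd_equiv_zmod_sq_prod hN (by simpa using hT 1) φ
  exact ⟨AddEquiv.ofBijective _ ((Nat.bijective_iff_injective_and_card _).2 ⟨hinj, hTS⟩)⟩

theorem fg_abelian_profinite_rigid (A B : Type*) [CommGroup A] [CommGroup B]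
    [Group.FG A] [Group.FG B]
    (h : Nonempty (ProfiniteCompletion A ≃* ProfiniteCompletion B)) :
    Nonempty (A ≃* B) := by
  obtain ⟨e⟩ := h
  obtain ⟨r, T, _, _, ⟨eA⟩⟩ := exists_equiv_free_prod_finite A
  obtain ⟨s, S, _, _, ⟨eB⟩⟩ := exists_equiv_free_prod_finite B
  obtain ⟨rfl, ⟨φ⟩⟩ : r = s ∧ Nonempty (T ≃+ S) := by
    refine rank_eq_and_nonempty_equiv_of_zmod_prod fun n hn hT hS => ?_
    have : NeZero n := ⟨hn⟩
    obtain ⟨p, hp, hpker⟩ := exists_hom_zmod_prod eA n hT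
    obtain ⟨q, hq, hqker⟩ := exists_hom_zmod_prod eB n hS
    obtain ⟨f, hf, hfker⟩ := ProfiniteCompletion.exists_hom_of_ker_eq_pow n p hp hpker
    obtain ⟨g, hg, hgker⟩ := ProfiniteCompletion.exists_hom_of_ker_eq_pow n q hq hqker
    obtain ⟨ψ⟩ := e.nonempty_quotient_pow n f hf hfker g hg hgker
    exact ⟨AddEquiv.toMultiplicative.symm ψ⟩
  exact ⟨MulEquiv.toAdditive.symm
    ((eA.trans ((AddEquiv.refl _).prodCongr φ)).trans eB.symm)⟩
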